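/- Let u ∈ S_n and let x be an invertible n×n real matrix such that x u⁻¹ admits a Gaussian decomposition. Then there exists v ∈ S_n with u ≤ v in the Bruhat order such that x ∈ B_- v B_-; that is, G_0 u ⊆ ∪_{v ≥ u} B_- v B_-. -/

import Mathlib

open scoped Classical

namespace BruhatTNN

abbrev Mat (n : ℕ) := Matrix (Fin n) (Fin n) ℝ

/-- `x` is upper unitriangular. -/
def upperUni {n : ℕ} (x : Mat n) : Prop :=
  (∀ i, x i i = 1) ∧ ∀ i j : Fin n, j < i → x i j = 0

/-- `x` is lower unitriangular. -/
def lowerUni {n : ℕ} (x : Mat n) : Prop :=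
  (∀ i, x i i = 1) ∧ ∀ i j : Fin n, i < j → x i j = 0

/-- `x` is invertible upper triangular (`x ∈ B`). -/
def upperTriInv {n : ℕ} (x : Mat n) : Prop :=
  IsUnit x.det ∧ ∀ i j : Fin n, j < i → x i j = 0

/-- `x` is invertible lower triangular (`x ∈ B_-`). -/
def lowerTriInv {n : ℕ} (x : Mat n) : Prop :=
  IsUnit x.det ∧ ∀ i j : Fin n, i < j → x i j = 0

/-- `x` is invertible diagonal (`x ∈ H`). -/
def diagInv {n : ℕ} (x : Mat n) : Prop :=
  IsUnit x.det ∧ ∀ i j : Fin n, i ≠ j → x i j = 0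

/-- `x` admits a Gaussian decomposition (`x ∈ G_0`). -/
def hasGauss {n : ℕ} (x : Mat n) : Prop :=
  ∃ a d b : Mat n, lowerUni a ∧ diagInv d ∧ upperUni b ∧ x = a * d * b

/-- The factor `[x]_-` of the Gaussian decomposition (junk value `1` if none exists). -/
noncomputable def gaussMinus {n : ℕ} (x : Mat n) : Mat n :=
  if h : hasGauss x then h.choose else 1

/-- The factor `[x]_0` of the Gaussian decomposition (junk value `1` if none exists). -/
noncomputable def gaussDiag {n : ℕ} (x : Mat n) : Mat n :=
  if h : hasGauss x then h.choose_spec.choose else 1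

/-- The factor `[x]_+` of the Gaussian decomposition (junk value `1` if none exists). -/
noncomputable def gaussPlus {n : ℕ} (x : Mat n) : Mat n :=
  if h : hasGauss x then h.choose_spec.choose_spec.choose else 1

/-- The permutation matrix of `w`, with entry `1` in position `(w j, j)`. -/
def permMat {n : ℕ} (w : Equiv.Perm (Fin n)) : Mat n :=
  Matrix.of fun i j => if i = w j then (1 : ℝ) else 0

/-- The minor of `x` with row set `I` and column set `J` (taken in increasing order). -/
def minorOf {n : ℕ} (x : Mat n) (k : ℕ) (I J : Finset (Fin n))
    (hI : I.card = k) (hJ : J.card = k) : ℝ :=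
  Matrix.det (Matrix.of fun a b : Fin k => x (I.orderEmbOfFin hI a) (J.orderEmbOfFin hJ b))

/-- `x` is totally nonnegative: all its minors are nonnegative. -/
def totNonneg {n : ℕ} (x : Mat n) : Prop :=
  ∀ (k : ℕ) (I J : Finset (Fin n)) (hI : I.card = k) (hJ : J.card = k),
    0 ≤ minorOf x k I J hI hJ

/-- The Bruhat order on the symmetric group. -/
def bruhatLE {n : ℕ} (u v : Equiv.Perm (Fin n)) : Prop :=
  ∀ i j : Fin n,
    (Finset.univ.filter fun k : Fin n => k ≤ i ∧ j ≤ u k).card ≤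
    (Finset.univ.filter fun k : Fin n => k ≤ i ∧ j ≤ v k).card

/-- The double coset `B_- w B_-`. -/
def doubleCosetBm {n : ℕ} (w : Equiv.Perm (Fin n)) : Set (Mat n) :=
  {x | ∃ b₁ b₂ : Mat n, lowerTriInv b₁ ∧ lowerTriInv b₂ ∧ x = b₁ * permMat w * b₂}

/-- `N^w = B_- w B_- ∩ N`. -/
def Ncell {n : ℕ} (w : Equiv.Perm (Fin n)) : Set (Mat n) :=
  {x | upperUni x ∧ x ∈ doubleCosetBm w}

/-- `N_-(w) = w⁻¹ N w ∩ N_-`. -/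
def Nminus {n : ℕ} (w : Equiv.Perm (Fin n)) : Set (Mat n) :=
  {x | lowerUni x ∧ ∃ y : Mat n, upperUni y ∧ x = permMat w⁻¹ * y * permMat w}

/-- `N(w) = w⁻¹ N w ∩ N`. -/
def Ngrp {n : ℕ} (w : Equiv.Perm (Fin n)) : Set (Mat n) :=
  {x | upperUni x ∧ ∃ y : Mat n, upperUni y ∧ x = permMat w⁻¹ * y * permMat w}

/-- The totally positive cell `Y°_w = Y ∩ B_- w B_-`. -/
def Ycirc {n : ℕ} (w : Equiv.Perm (Fin n)) : Set (Mat n) :=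
  {x | upperUni x ∧ totNonneg x ∧ x ∈ doubleCosetBm w}

/-- `Y_{≥ u} = ⋃_{v ≥ u} Y°_v`. -/
def Yge {n : ℕ} (u : Equiv.Perm (Fin n)) : Set (Mat n) :=
  {x | ∃ v, bruhatLE u v ∧ x ∈ Ycirc v}

/-- `A = u⁻¹ [x u⁻¹]_+ u`. -/
noncomputable def Amat {n : ℕ} (u : Equiv.Perm (Fin n)) (x : Mat n) : Mat n :=
  permMat u⁻¹ * gaussPlus (x * permMat u⁻¹) * permMat u

/-- The projection `π_u(x) = [u [u⁻¹ [x u⁻¹]_+ u]_-]_+`. -/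
noncomputable def piMap {n : ℕ} (u : Equiv.Perm (Fin n)) (x : Mat n) : Mat n :=
  gaussPlus (permMat u * gaussMinus (Amat u x))

/-- `str(M)`: the sum of the matrix entries immediately above the main diagonal. -/
def strAbove {n : ℕ} (M : Mat n) : ℝ :=
  ∑ p : Fin n × Fin n, if (p.1 : ℕ) + 1 = (p.2 : ℕ) then M p.1 p.2 else 0

/-- The number of inversions (the length) of a permutation. -/
def invNum {n : ℕ} (w : Equiv.Perm (Fin n)) : ℕ :=
  (Finset.univ.filter fun p : Fin n × Fin n => p.1 < p.2 ∧ w p.2 < w p.1).card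

theorem permMat_mulVec_apply {n : ℕ} (w : Equiv.Perm (Fin n)) (y : Fin n → ℝ) (k : Fin n) :
    (permMat w).mulVec y (w k) = y k := by
  simp [permMat, Matrix.mulVec, dotProduct]

theorem permMat_inv_mul {n : ℕ} (w : Equiv.Perm (Fin n)) : permMat w⁻¹ * permMat w = 1 := by
  ext i j
  simp [permMat, Matrix.mul_apply, Matrix.one_apply]

theorem lowerTriInv.inv {n : ℕ} {L : Mat n} (hL : lowerTriInv L) : lowerTriInv L⁻¹ := by
  have hB : L.BlockTriangular OrderDual.toDual := fun i j h => hL.2 i j h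
  have := L.invertibleOfIsUnitDet hL.1
  exact ⟨Matrix.isUnit_nonsing_inv_det L hL.1,
    fun i j h => Matrix.blockTriangular_inv_of_blockTriangular hB h⟩

theorem lowerTriInv.mulVec_eq_zero {n : ℕ} {L : Mat n} (hL : lowerTriInv L) {y : Fin n → ℝ}
    {j : Fin n} (hy : ∀ r < j, y r = 0) (r : Fin n) (hr : r < j) : L.mulVec y r = 0 := by
  rw [Matrix.mulVec, dotProduct]
  refine Finset.sum_eq_zero fun k _ => ?_
  rcases le_or_gt k r with h | h
  · rw [hy k (h.trans_lt hr), mul_zero]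
  · rw [hL.2 r k h, zero_mul]

theorem lowerUni.lowerTriInv {n : ℕ} {L : Mat n} (hL : lowerUni L) : lowerTriInv L := by
  refine ⟨?_, hL.2⟩
  rw [Matrix.det_of_isLowerTriangular L fun i j h => hL.2 i j h]
  simp [hL.1]

theorem upperUni.isUnit_det {n : ℕ} {U : Mat n} (hU : upperUni U) : IsUnit U.det := by
  rw [Matrix.det_of_isUpperTriangular (M := U) fun i j h => hU.2 i j h]
  simp [hU.1]

theorem lowerTriInv.mul_diagInv {n : ℕ} {L d : Mat n} (hL : lowerTriInv L) (hd : diagInv d) :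
    lowerTriInv (L * d) := by
  refine ⟨by simpa using And.intro hL.1.ne_zero hd.1.ne_zero, fun i j h => ?_⟩
  rw [Matrix.mul_apply]
  refine Finset.sum_eq_zero fun k _ => ?_
  rcases eq_or_ne k j with rfl | hk
  · rw [hL.2 i k h, zero_mul]
  · rw [hd.2 k j hk, mul_zero]

/-- For an invertible matrix, each row can be modified by earlier rows so that its last nonzero
entry is as far to the left as possible. -/
theorem exists_minimal_row {n : ℕ} (x : Mat n) (hx : IsUnit x.det) (i : Fin n) :
    ∃ (c : Fin n → ℝ) (p : Fin n), c i = 1 ∧ (∀ k, i < k → c k = 0) ∧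
      Matrix.vecMul c x p ≠ 0 ∧ (∀ k, p < k → Matrix.vecMul c x k = 0) ∧
      ∀ c' : Fin n → ℝ, c' i = 1 → (∀ k, i < k → c' k = 0) →
        ∃ k, p ≤ k ∧ Matrix.vecMul c' x k ≠ 0 := by
  have hex : ∃ m : ℕ, ∃ c : Fin n → ℝ, c i = 1 ∧ (∀ k, i < k → c k = 0) ∧
      ∀ k : Fin n, m ≤ k → Matrix.vecMul c x k = 0 :=
    ⟨n, Pi.single i 1, by simp, fun k hk => by simp [hk.ne'], fun k hk => by omega⟩
  obtain ⟨c, hc1, hc2, hc3⟩ := Nat.find_spec hex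
  have hmin := fun m => Nat.find_min hex (m := m)
  generalize Nat.find hex = m at hc3 hmin
  have hne : ∃ k, Matrix.vecMul c x k ≠ 0 := by
    by_contra! h
    have := Matrix.eq_zero_of_vecMul_eq_zero hx.ne_zero (funext h)
    simp [this] at hc1
  obtain ⟨k₀, hk₀⟩ := hne
  have hk₀m : (k₀ : ℕ) < m := by
    by_contra! h
    exact hk₀ (hc3 k₀ h)
  have hkey : ∀ c' : Fin n → ℝ, c' i = 1 → (∀ k, i < k → c' k = 0) →
        ∃ k : Fin n, m - 1 ≤ (k : ℕ) ∧ Matrix.vecMul c' x k ≠ 0 := by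
    intro c' h1 h2
    by_contra! h
    exact hmin (m - 1) (by omega) ⟨c', h1, h2, h⟩
  obtain ⟨p, hp, hp'⟩ := hkey c hc1 hc2
  have hpm : (p : ℕ) = m - 1 := by
    by_contra hcon
    exact hp' (hc3 p (by omega))
  refine ⟨c, p, hc1, hc2, hp', fun k hk => hc3 k ?_, fun c' h1 h2 => ?_⟩
  · have : (p : ℕ) < k := hk
    omega
  · obtain ⟨k, hk, hk'⟩ := hkey c' h1 h2
    exact ⟨k, Fin.le_def.2 (hpm ▸ hk), hk'⟩

/-- **Bruhat decomposition**: every invertible matrix lies in some double coset `B_- v B_-`. -/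
theorem exists_mem_doubleCosetBm {n : ℕ} (x : Mat n) (hx : IsUnit x.det) :
    ∃ v : Equiv.Perm (Fin n), x ∈ doubleCosetBm v := by
  choose c p hc1 hc0 hp hp0 hmin using exists_minimal_row x hx
  have hlt : ∀ i j, i < j → p i ≠ p j := by
    intro i j hij hpij
    set t := Matrix.vecMul (c j) x (p j) / Matrix.vecMul (c i) x (p i) with ht
    obtain ⟨k, hk, hk'⟩ := hmin j (c j - t • c i) (by simp [hc1, hc0 i j hij])
      (fun k hk => by simp [hc0 j k hk, hc0 i k (hij.trans hk)])
    apply hk'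
    rw [Matrix.sub_vecMul, Matrix.smul_vecMul]
    rcases hk.eq_or_lt with rfl | hk
    · have h := hp i
      rw [hpij] at ht h
      simp [ht, h]
    · simp [hp0 j k hk, hp0 i k (hpij ▸ hk)]
  have hinj : Function.Injective p := by
    intro i j hij
    rcases lt_trichotomy i j with h | h | h
    · exact (hlt i j h hij).elim
    · exact h
    · exact (hlt j i h hij.symm).elim
  let q : Equiv.Perm (Fin n) := Equiv.ofBijective p (Finite.injective_iff_bijective.1 hinj)
  have hq : ∀ k, p (q.symm k) = k := fun k => q.apply_symm_apply k
  let L : Mat n := Matrix.of c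
  have hL : lowerTriInv L := lowerUni.lowerTriInv ⟨hc1, hc0⟩
  let R : Mat n := Matrix.of fun k => Matrix.vecMul (c (q.symm k)) x
  have hR0 : ∀ i j : Fin n, i < j → R i j = 0 := fun i j h => hp0 _ _ (by rwa [hq])
  have hR : lowerTriInv R := by
    refine ⟨?_, hR0⟩
    rw [Matrix.det_of_isLowerTriangular R fun i j h => hR0 i j h, isUnit_iff_ne_zero]
    refine Finset.prod_ne_zero_iff.2 fun k _ => ?_
    have := hp (q.symm k)
    rwa [hq] at this
  refine ⟨q.symm, L⁻¹, R, hL.inv, hR, ?_⟩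
  have hLx : L * x = permMat q.symm * R := by
    ext i j
    have h := permMat_mulVec_apply q.symm (fun k => R k j) (q i)
    rw [Equiv.symm_apply_apply] at h
    refine Eq.trans ?_ h.symm
    simp [R, L, Matrix.mul_apply, Matrix.vecMul, dotProduct]
  rw [mul_assoc, ← hLx, Matrix.nonsing_inv_mul_cancel_left _ _ hL.1]

/-- The Bruhat order in terms of the north-east rank function. -/
theorem bruhatLE_of_card_le {n : ℕ} {u v : Equiv.Perm (Fin n)}
    (h : ∀ i j : Fin n, (Finset.univ.filter fun k : Fin n => i < k ∧ u k < j).card ≤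
      (Finset.univ.filter fun k : Fin n => i < k ∧ v k < j).card) : bruhatLE u v := by
  intro i j
  have key : ∀ w : Equiv.Perm (Fin n),
      (Finset.univ.filter fun k : Fin n => k ≤ i ∧ j ≤ w k).card +
        (Finset.univ.filter fun k : Fin n => k < j).card =
      (Finset.univ.filter fun k : Fin n => i < k ∧ w k < j).card +
        (Finset.univ.filter fun k : Fin n => k ≤ i).card := by
    intro w
    have hw : (Finset.univ.filter fun k : Fin n => k < j).card =
        (Finset.univ.filter fun k : Fin n => w k < j).card := by
      symm
      refine Finset.card_bij (fun k _ => w k) (by simp) (by simp) fun b hb => ⟨w.symm b, ?_⟩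
      simpa using hb
    rw [hw, ← Finset.card_filter_add_card_filter_not (s := Finset.univ.filter fun k => w k < j)
        (fun k => k ≤ i),
      ← Finset.card_filter_add_card_filter_not (s := Finset.univ.filter fun k => k ≤ i)
        (fun k => w k < j)]
    simp only [Finset.filter_filter, not_le, not_lt, and_comm]
    omega
  have hu := key u
  have hv := key v
  have := h i j
  omega

/-- If `B_- U u` meets `B_- v B_-` with `U` upper unitriangular, then the north-east rank function
of `u` is bounded by that of `v`. -/
theorem card_le_of_mul_eq {n : ℕ} {u v : Equiv.Perm (Fin n)} {L U b₁ b₂ : Mat n}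
    (hL : lowerTriInv L) (hU : upperUni U) (h₁ : lowerTriInv b₁) (h₂ : lowerTriInv b₂)
    (h : L * U * permMat u = b₁ * permMat v * b₂) (i j : Fin n) :
    (Finset.univ.filter fun k : Fin n => i < k ∧ u k < j).card ≤
      (Finset.univ.filter fun k : Fin n => i < k ∧ v k < j).card := by
  by_contra! hcard
  let S := {k : Fin n // i < k ∧ u k < j}
  let T := {k : Fin n // i < k ∧ v k < j}
  let f : (S → ℝ) →ₗ[ℝ] (T → ℝ) :=
    Matrix.mulVecLin (b₂.submatrix (Subtype.val : T → Fin n) (Subtype.val : S → Fin n))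
  have hf : Module.finrank ℝ (T → ℝ) < Module.finrank ℝ (S → ℝ) := by
    simpa [S, T, Fintype.card_subtype] using hcard
  obtain ⟨c, hc, hc0⟩ := (Submodule.ne_bot_iff _).1 (LinearMap.ker_ne_bot_of_finrank_lt (f := f) hf)
  let e : Fin n → ℝ := fun k => if hk : i < k ∧ u k < j then c ⟨k, hk⟩ else 0
  have he : ∀ k, ¬(i < k ∧ u k < j) → e k = 0 := fun k hk => dif_neg hk
  have hy : ∀ k, v k < j → b₂.mulVec e k = 0 := by
    intro k hk
    by_cases hik : i < k
    · have h0 : f c ⟨k, hik, hk⟩ = 0 := by rw [LinearMap.mem_ker.1 hc]; rfl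
      rw [← h0]
      have hsub : ∑ m ∈ Finset.univ.filter (fun m : Fin n => i < m ∧ u m < j), b₂ k m * e m =
          ∑ s : S, b₂ k s * e s := Finset.sum_subtype _ (by simp) _
      rw [Matrix.mulVec, dotProduct, ← Finset.sum_filter_of_ne (p := fun m => i < m ∧ u m < j)
        (fun m _ hm => by by_contra hcon; exact hm (by rw [he m hcon, mul_zero])), hsub]
      refine Finset.sum_congr rfl fun s _ => ?_
      simp [e, s.2]
    · rw [Matrix.mulVec, dotProduct]
      refine Finset.sum_eq_zero fun m _ => ?_
      by_cases him : i < m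
      · rw [h₂.2 k m ((not_lt.1 hik).trans_lt him), zero_mul]
      · rw [he m fun hm => him hm.1, mul_zero]
  let z := (permMat u).mulVec e
  have hz : ∀ r, j ≤ r → z r = 0 := by
    intro r hr
    obtain ⟨k, rfl⟩ := u.surjective r
    exact (permMat_mulVec_apply u e k).trans (he k fun hk => hk.2.not_ge hr)
  have hPv : ∀ r < j, (permMat v).mulVec (b₂.mulVec e) r = 0 := by
    intro r hr
    obtain ⟨k, rfl⟩ := v.surjective r
    rw [permMat_mulVec_apply]
    exact hy k hr
  have hLUz : ∀ r < j, L.mulVec (U.mulVec z) r = 0 := by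
    have : L.mulVec (U.mulVec z) = b₁.mulVec ((permMat v).mulVec (b₂.mulVec e)) := by
      simp only [z, Matrix.mulVec_mulVec, ← mul_assoc, h]
    rw [this]
    exact h₁.mulVec_eq_zero hPv
  have hUz : ∀ r < j, U.mulVec z r = 0 := by
    have : U.mulVec z = L⁻¹.mulVec (L.mulVec (U.mulVec z)) := by
      rw [Matrix.mulVec_mulVec (U.mulVec z) L⁻¹ L, Matrix.nonsing_inv_mul _ hL.1, Matrix.one_mulVec]
    rw [this]
    exact hL.inv.mulVec_eq_zero hLUz
  have hUz0 : U.mulVec z = 0 := by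
    funext r
    rcases lt_or_ge r j with hr | hr
    · exact hUz r hr
    · rw [Pi.zero_apply, Matrix.mulVec, dotProduct]
      refine Finset.sum_eq_zero fun m _ => ?_
      rcases lt_or_ge m r with hm | hm
      · rw [hU.2 r m hm, zero_mul]
      · rw [hz m (hr.trans hm), mul_zero]
  have hz0 : z = 0 := Matrix.eq_zero_of_mulVec_eq_zero hU.isUnit_det.ne_zero hUz0
  apply hc0
  funext s
  have hs := permMat_mulVec_apply u e s
  rw [show (permMat u).mulVec e = 0 from hz0] at hs
  simpa [e, s.2] using hs.symm

theorem statement7 (n : ℕ) (hn : 1 ≤ n) (u : Equiv.Perm (Fin n)) (x : Mat n)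
    (hx : IsUnit x.det) (hg : hasGauss (x * permMat u⁻¹)) :
    ∃ v : Equiv.Perm (Fin n), bruhatLE u v ∧ x ∈ doubleCosetBm v := by
  obtain ⟨v, hv⟩ := exists_mem_doubleCosetBm x hx
  refine ⟨v, bruhatLE_of_card_le ?_, hv⟩
  obtain ⟨b₁, b₂, h₁, h₂, h⟩ := hv
  obtain ⟨a, d, b, ha, hd, hb, hg⟩ := hg
  refine card_le_of_mul_eq (ha.lowerTriInv.mul_diagInv hd) hb h₁ h₂ ?_
  rw [← h, ← hg, mul_assoc, permMat_inv_mul, mul_one]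

end BruhatTNN
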